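/- Let d ≥ 2 and let Δ be a flag simplicial complex of dimension d−1 whose geometric realization is homeomorphic to the sphere S^{d−1}, and suppose Δ has exactly 2d+2 vertices (equivalently γ_1(Δ) = 2). Then the γ-polynomial of Δ is either 1 + 2t or 1 + 2t + t²; equivalently, h(Δ;t) equals (1+t)^d + 2t(1+t)^{d−2} or (1+t)^d + 2t(1+t)^{d−2} + t²(1+t)^{d−4}. -/

import Mathlib

open Polynomial Finset

/-- The geometric realization of a simplicial complex `Δ` with vertices `Fin N`:
the points of the standard simplex on the vertex set whose support is a face. -/
def realize {N : ℕ} (Δ : Finset (Finset (Fin N))) : Set (Fin N → ℝ) :=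
  {x | ∃ F ∈ Δ, (∀ v, 0 ≤ x v) ∧ (∀ v, x v ≠ 0 → v ∈ F) ∧ (∑ v, x v) = 1}

/-- The `h`-polynomial `h(Δ;t) = (1-t)^d f(Δ; t/(1-t)) = Σ_{F ∈ Δ} t^{|F|} (1-t)^{d-|F|}`
of a `(d-1)`-dimensional simplicial complex. -/
noncomputable def hPoly (d : ℕ) {N : ℕ} (Δ : Finset (Finset (Fin N))) : Polynomial ℤ :=
  ∑ F ∈ Δ, X ^ F.card * (1 - X) ^ (d - F.card)

open scoped NNReal in
theorem exists_lipschitzWith_indicator_closedBall {E : Type*} [NormedAddCommGroup E]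
    [NormedSpace ℝ E] {k : E → E} {R : ℝ} {C : ℝ≥0}
    (hk : LipschitzOnWith C k (Metric.closedBall 0 R))
    (h0 : ∀ x, ‖x‖ = R → k x = 0) :
    LipschitzWith C ((Metric.closedBall 0 R).indicator k) := by
  have key : ∀ x y : E, ‖x‖ ≤ R → R < ‖y‖ → ‖k x‖ ≤ C * ‖x - y‖ := by
    intro x y hx hy
    have hc : ContinuousOn (fun t : ℝ => ‖x + t • (y - x)‖) (Set.Icc 0 1) := by fun_prop
    obtain ⟨t, ht, hz⟩ := intermediate_value_Icc zero_le_one hc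
      (show R ∈ Set.Icc _ _ by constructor <;> simp [hx, hy.le])
    have h1 := hk.norm_sub_le (x := x) (y := x + t • (y - x)) (by simpa using hx)
      (by simpa using hz.le)
    rw [h0 _ hz, sub_zero] at h1
    refine h1.trans (mul_le_mul_of_nonneg_left ?_ C.2)
    rw [sub_add_cancel_left, norm_neg, norm_smul, Real.norm_of_nonneg ht.1, norm_sub_rev x y]
    exact mul_le_of_le_one_left (norm_nonneg _) ht.2
  refine LipschitzWith.of_dist_le_mul fun x y => ?_
  rw [dist_eq_norm, dist_eq_norm]
  by_cases hx : ‖x‖ ≤ R <;> by_cases hy : ‖y‖ ≤ R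
  · simpa [hx, hy] using hk.norm_sub_le (x := x) (y := y) (by simpa using hx) (by simpa using hy)
  · simpa [hx, hy] using key x y hx (not_le.1 hy)
  · simpa [hx, hy, norm_sub_rev] using key y x hy (not_le.1 hx)
  · simp only [Metric.mem_closedBall, dist_zero_right, hx, not_false_eq_true,
      Set.indicator_of_notMem, hy, sub_self, norm_zero]
    positivity

theorem exists_polynomial_eval_eq_det {E : Type*} [NormedAddCommGroup E] [NormedSpace ℝ E]
    [FiniteDimensional ℝ E] (A : E →L[ℝ] E) :
    ∃ p : ℝ[X], p.natDegree ≤ Module.finrank ℝ E ∧ ∀ t : ℝ, p.eval t = (1 + t • A).det := by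
  let b := Module.finBasis ℝ E
  let M := LinearMap.toMatrix b b (A : E →ₗ[ℝ] E)
  refine ⟨((X : ℝ[X]) • M.map C + (1 : Matrix _ _ ℝ).map C).det, ?_, fun t => ?_⟩
  · simpa using Polynomial.natDegree_det_X_add_C_le M 1
  · have h := LinearMap.det_toMatrix b ((1 + t • A : E →L[ℝ] E) : E →ₗ[ℝ] E)
    change _ = LinearMap.det ((1 + t • A : E →L[ℝ] E) : E →ₗ[ℝ] E)
    rw [← h, ← Polynomial.coe_evalRingHom, RingHom.map_det]
    congr 1
    have : LinearMap.toMatrix b b ((1 + t • A : E →L[ℝ] E) : E →ₗ[ℝ] E) = 1 + t • M := by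
      ext i j
      simp [M, LinearMap.toMatrix_apply, Matrix.one_apply, Finsupp.single_apply, eq_comm]
    rw [this]
    ext i j
    simp [Matrix.one_apply]
    split_ifs <;> simp [add_comm, mul_comm]

theorem det_one_add_smul_pos {E : Type*} [NormedAddCommGroup E] [NormedSpace ℝ E]
    [FiniteDimensional ℝ E] {A : E →L[ℝ] E} {t : ℝ} (ht : 0 ≤ t) (h : t * ‖A‖ < 1) :
    0 < (1 + t • A).det := by
  obtain ⟨p, -, hp⟩ := exists_polynomial_eval_eq_det A
  rw [← hp]
  by_contra! hneg
  obtain ⟨s, hs, h0⟩ := intermediate_value_Icc' ht p.continuous.continuousOn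
    (show (0 : ℝ) ∈ Set.Icc _ _ from ⟨hneg, by simp [hp, ContinuousLinearMap.det]⟩)
  simp only [hp] at h0
  have hker := LinearMap.bot_lt_ker_of_det_eq_zero (f := ((1 + s • A : E →L[ℝ] E) : E →ₗ[ℝ] E)) h0
  obtain ⟨v, hv, hv0⟩ := (Submodule.ne_bot_iff _).1 hker.ne'
  have hv' : v = -(s • A v) := eq_neg_of_add_eq_zero_left (by simpa using hv)
  have hn : ‖v‖ ≤ s * (‖A‖ * ‖v‖) := by
    conv_lhs => rw [hv', norm_neg, norm_smul, Real.norm_of_nonneg hs.1]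
    exact mul_le_mul_of_nonneg_left (A.le_opNorm v) hs.1
  have hs' : s * ‖A‖ < 1 := (mul_le_mul_of_nonneg_right hs.2 (norm_nonneg _)).trans_lt h
  have := norm_pos_iff.2 hv0
  nlinarith

open MeasureTheory in
open scoped NNReal in
theorem setIntegral_det_one_add_smul_fderiv {E : Type*} [NormedAddCommGroup E]
    [InnerProductSpace ℝ E] [FiniteDimensional ℝ E] [MeasurableSpace E] [BorelSpace E]
    {r : E → E} {R : ℝ} {C : ℝ≥0} (hr : ContDiff ℝ 1 r)
    (hid : ∀ x, ‖x‖ = R → r x = x)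
    (hk : LipschitzWith C ((Metric.closedBall 0 R).indicator fun x => r x - x))
    {t : ℝ} (ht : 0 ≤ t) (htC : t * C < 1) :
    ∫ x in Metric.ball (0 : E) R, (1 + t • (fderiv ℝ r x - 1)).det =
      volume.real (Metric.ball (0 : E) R) := by
  set k := (Metric.closedBall 0 R).indicator fun x => r x - x with hkdef
  set f : E → E := fun x => x + t • k x with hf
  have hinj : Function.Injective f := by
    intro x y hxy
    have h1 : x - y = -(t • (k x - k y)) := by
      simp only [hf] at hxy
      rw [smul_sub, neg_sub, sub_eq_sub_iff_add_eq_add, hxy, add_comm]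
    have h2 : ‖x - y‖ ≤ t * (C * ‖x - y‖) := by
      conv_lhs => rw [h1, norm_neg, norm_smul, Real.norm_of_nonneg ht]
      exact mul_le_mul_of_nonneg_left (hk.norm_sub_le x y) ht
    by_contra hne
    have := norm_pos_iff.2 (sub_ne_zero.2 hne)
    nlinarith
  have hsurj : Function.Surjective f := by
    have ha : ApproximatesLinearOn f ((ContinuousLinearEquiv.refl ℝ E : E ≃L[ℝ] E) : E →L[ℝ] E)
        Set.univ (⟨t, ht⟩ * C) := by
      intro x _ y _
      have : f x - f y - (x - y) = t • (k x - k y) := by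
        simp only [hf, smul_sub]; abel
      simp only [ContinuousLinearEquiv.coe_refl, ContinuousLinearMap.id_apply, this]
      rw [norm_smul, Real.norm_of_nonneg ht]
      have := mul_le_mul_of_nonneg_left (hk.norm_sub_le x y) ht
      calc _ ≤ _ := this
        _ = t * C * ‖x - y‖ := (mul_assoc _ _ _).symm
    refine ha.surjective ?_
    rcases subsingleton_or_nontrivial E with hE | hE
    · exact Or.inl hE
    · right
      simp only [ContinuousLinearEquiv.refl_symm, ContinuousLinearEquiv.coe_refl]
      rw [show ‖ContinuousLinearMap.id ℝ E‖₊ = 1 from NNReal.eq ContinuousLinearMap.norm_id]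
      rw [inv_one]
      exact_mod_cast htC
  have hout : ∀ x, x ∉ Metric.ball (0 : E) R → f x = x := by
    intro x hx
    rw [mem_ball_zero_iff, not_lt] at hx
    simp only [hf, hkdef]
    rcases hx.eq_or_lt with h | h
    · rw [Set.indicator_of_mem (by simp [h]), hid x h.symm, sub_self, smul_zero, add_zero]
    · rw [Set.indicator_of_notMem (by simpa using h), smul_zero, add_zero]
  have himage : f '' Metric.ball (0 : E) R = Metric.ball 0 R := by
    ext y
    constructor
    · rintro ⟨x, hx, rfl⟩
      by_contra hn
      exact hn (by rwa [hinj (hout _ hn)])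
    · intro hy
      obtain ⟨x, rfl⟩ := hsurj y
      refine ⟨x, ?_, rfl⟩
      by_contra hn
      exact hn (by rwa [hout x hn] at hy)
  have hnear : ∀ x ∈ Metric.ball (0 : E) R, k =ᶠ[nhds x] fun y => r y - y := by
    intro x hx
    filter_upwards [Metric.isOpen_ball.mem_nhds hx] with y hy
    simp only [hkdef]
    rw [Set.indicator_of_mem (Metric.ball_subset_closedBall hy)]
  have hkd : ∀ x ∈ Metric.ball (0 : E) R, HasFDerivAt k (fderiv ℝ r x - 1) x := fun x hx =>
    ((hr.differentiable one_ne_zero x).hasFDerivAt.sub (hasFDerivAt_id x)).congr_of_eventuallyEq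
      (hnear x hx)
  have hfd : ∀ x ∈ Metric.ball (0 : E) R,
      HasFDerivWithinAt f (1 + t • (fderiv ℝ r x - 1)) (Metric.ball 0 R) x := fun x hx =>
    ((hasFDerivAt_id x).add ((hkd x hx).const_smul t)).hasFDerivWithinAt
  have h1 := integral_image_eq_integral_abs_det_fderiv_smul volume
    (Metric.isOpen_ball (x := (0 : E)) (ε := R)).measurableSet hfd hinj.injOn (fun _ => (1 : ℝ))
  rw [himage] at h1
  simp only [integral_const, MeasurableSet.univ, measureReal_restrict_apply, Set.univ_inter,
    smul_eq_mul, mul_one] at h1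
  rw [h1]
  refine setIntegral_congr_fun Metric.isOpen_ball.measurableSet fun x hx => (abs_of_pos ?_).symm
  refine det_one_add_smul_pos ht (lt_of_le_of_lt ?_ htC)
  have := norm_fderiv_le_of_lipschitz ℝ hk (x₀ := x)
  rw [(hkd x hx).fderiv] at this
  exact mul_le_mul_of_nonneg_left this ht

theorem det_fderiv_eq_zero_of_norm_eq {E : Type*} [NormedAddCommGroup E]
    [InnerProductSpace ℝ E] [FiniteDimensional ℝ E] {r : E → E} {R : ℝ} (hR : 0 < R)
    (hn : ∀ x, ‖r x‖ = R) {x : E} (hr : DifferentiableAt ℝ r x) : (fderiv ℝ r x).det = 0 := by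
  by_contra hdet
  have hs : Function.Surjective (fderiv ℝ r x) :=
    ((LinearMap.equivOfDetNeZero ((fderiv ℝ r x : E →L[ℝ] E) : E →ₗ[ℝ] E) hdet)).surjective
  obtain ⟨v, hv⟩ := hs (r x)
  have h1 := (hr.hasFDerivAt.inner ℝ hr.hasFDerivAt)
  have h2 : (fun y => inner ℝ (r y) (r y)) = fun _ => R ^ 2 := by
    funext y; rw [real_inner_self_eq_norm_sq, hn]
  rw [h2] at h1
  have h3 := congrArg (fun L : E →L[ℝ] ℝ => L v) (h1.unique (hasFDerivAt_const _ _))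
  simp [hv, hn] at h3
  nlinarith

open MeasureTheory in
theorem not_exists_contDiff_retraction {E : Type*} [NormedAddCommGroup E]
    [InnerProductSpace ℝ E] [FiniteDimensional ℝ E] {r : E → E} {R : ℝ} (hR : 0 < R)
    (hr : ContDiff ℝ 1 r) (hn : ∀ x, ‖r x‖ = R) (hid : ∀ x, ‖x‖ = R → r x = x) : False := by
  borelize E
  obtain ⟨C, hC⟩ : ∃ C, LipschitzOnWith C (fun x => r x - x) (Metric.closedBall 0 R) := by
    obtain ⟨C, hC⟩ := (isCompact_closedBall (0 : E) R).bddAbove_image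
      (f := fun x => ‖fderiv ℝ (fun x => r x - x) x‖)
      (((hr.sub contDiff_id).continuous_fderiv one_ne_zero).norm.continuousOn)
    refine ⟨C.toNNReal, (convex_closedBall (0 : E) R).lipschitzOnWith_of_nnnorm_fderiv_le
      (𝕜 := ℝ) (fun x _ => ((hr.sub contDiff_id).differentiable one_ne_zero x)) fun x hx => ?_⟩
    rw [← NNReal.coe_le_coe, coe_nnnorm]
    exact (hC ⟨x, hx, rfl⟩).trans (Real.le_coe_toNNReal C)
  have hk := exists_lipschitzWith_indicator_closedBall hC fun x hx => by simp [hid x hx]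
  set n := Module.finrank ℝ E
  let v : ℕ → ℝ := fun j => (j : ℝ) / ((n + 1) * (C + 1))
  have hCp : (0 : ℝ) < C + 1 := by positivity
  have hv0 : ∀ j, 0 ≤ v j := fun j => by positivity
  have hv1 : ∀ j ∈ range (n + 1), v j * C < 1 := by
    intro j hj
    have : (j : ℝ) ≤ n := by exact_mod_cast Nat.lt_succ_iff.1 (mem_range.1 hj)
    simp only [v]
    rw [div_mul_eq_mul_div, div_lt_one (by positivity)]
    have := C.coe_nonneg
    nlinarith [mul_le_mul_of_nonneg_right ‹(j : ℝ) ≤ n› this]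
  have hvinj : Set.InjOn v (range (n + 1) : Set ℕ) := by
    intro i _ j _ hij
    simp only [v] at hij
    rw [div_left_inj' (by positivity)] at hij
    exact_mod_cast hij
  let L : ℕ → ℝ := fun j => (Lagrange.basis (range (n + 1)) v j).eval 1
  have hL : ∑ j ∈ range (n + 1), L j = 1 := by
    have := congrArg (eval (1 : ℝ)) (Lagrange.sum_basis hvinj ⟨0, by simp⟩)
    simpa [eval_finsetSum] using this
  have hdet : ∀ x, ∑ j ∈ range (n + 1), L j * (1 + v j • (fderiv ℝ r x - 1)).det = 0 := by
    intro x
    obtain ⟨p, hp, he⟩ := exists_polynomial_eval_eq_det (fderiv ℝ r x - 1)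
    have h1 := congrArg (eval (1 : ℝ)) (Lagrange.eq_interpolate (f := p) hvinj
      (lt_of_le_of_lt degree_le_natDegree
        (by rw [card_range]; exact_mod_cast Nat.lt_succ_of_le hp)))
    rw [he, one_smul, add_sub_cancel,
      det_fderiv_eq_zero_of_norm_eq hR hn (hr.differentiable one_ne_zero x),
      Lagrange.interpolate_apply, eval_finsetSum] at h1
    rw [h1]
    refine Finset.sum_congr rfl fun j _ => ?_
    rw [eval_mul, eval_C, he, mul_comm]
  have hcont : ∀ t : ℝ, Continuous fun x => (1 + t • (fderiv ℝ r x - 1)).det := fun t =>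
    ContinuousLinearMap.continuous_det.comp
      (continuous_const.add
        (((hr.continuous_fderiv one_ne_zero).sub continuous_const).const_smul t))
  have hint : ∀ t : ℝ, IntegrableOn (fun x => (1 + t • (fderiv ℝ r x - 1)).det)
      (Metric.ball (0 : E) R) := fun t =>
    ((hcont t).continuousOn.integrableOn_compact (isCompact_closedBall 0 R)).mono_set
      Metric.ball_subset_closedBall
  have hsum : ∑ j ∈ range (n + 1), L j * volume.real (Metric.ball (0 : E) R) = 0 := by
    calc _ = ∑ j ∈ range (n + 1), ∫ x in Metric.ball (0 : E) R,
          L j * (1 + v j • (fderiv ℝ r x - 1)).det := by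
          refine Finset.sum_congr rfl fun j hj => ?_
          rw [integral_const_mul, setIntegral_det_one_add_smul_fderiv hr hid hk (hv0 j) (hv1 j hj)]
      _ = 0 := by
          rw [← integral_finsetSum _ fun j _ => (hint (v j)).const_mul (L j)]
          simp [hdet]
  rw [← Finset.sum_mul, hL, one_mul] at hsum
  exact (ENNReal.toReal_pos (Metric.measure_ball_pos volume (0 : E) hR).ne'
    measure_ball_lt_top.ne).ne' hsum

theorem exists_add_eq_zero_of_support_subset {E : Type*} [NormedAddCommGroup E]
    [InnerProductSpace ℝ E] [FiniteDimensional ℝ E] {g : E → E} {R : ℝ} (hR : 0 < R)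
    (hg : Continuous g) (hs : ∀ x, R ≤ ‖x‖ → g x = 0) : ∃ x, x + g x = 0 := by
  by_contra! hne
  obtain ⟨w, hw, hwg, hws⟩ := hg.exists_contDiff_approx 1 (ε := fun x => ‖x + g x‖)
    (by fun_prop) (fun x => norm_pos_iff.2 (hne x))
  have hne' : ∀ x, x + w x ≠ 0 := by
    intro x hx
    have h := hwg x
    rw [dist_eq_norm, eq_neg_of_add_eq_zero_right hx, ← neg_add', norm_neg] at h
    exact lt_irrefl _ h
  refine not_exists_contDiff_retraction hR (r := fun x => (R * ‖x + w x‖⁻¹) • (x + w x)) ?_ ?_ ?_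
  · have h1 : ContDiff ℝ 1 fun x => x + w x := contDiff_id.add hw
    exact (contDiff_const.mul ((h1.norm ℝ hne').inv fun x => norm_ne_zero_iff.2 (hne' x))).smul h1
  · intro x
    rw [norm_smul, norm_mul, norm_inv, norm_norm, mul_assoc,
      inv_mul_cancel₀ (norm_ne_zero_iff.2 (hne' x)), mul_one, Real.norm_of_nonneg hR.le]
  · intro x hx
    have : w x = 0 := by
      by_contra h
      exact hws h (hs x hx.ge)
    simp [this, hx, hR.ne']

/-- A form of Brouwer's fixed point theorem. -/
theorem exists_eq_zero_of_norm_sub_le {E : Type*} [NormedAddCommGroup E]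
    [InnerProductSpace ℝ E] [FiniteDimensional ℝ E] {h : E → E}
    (hc : ContinuousOn h (Metric.closedBall 0 1))
    (hh : ∀ x, ‖x‖ ≤ 1 → ‖h x - x‖ ≤ 1) : ∃ x, ‖x‖ ≤ 1 ∧ h x = 0 := by
  let p : E → E := fun x => (max 1 ‖x‖)⁻¹ • x
  have hm : ∀ x : E, 0 < max 1 ‖x‖ := fun x => lt_max_of_lt_left one_pos
  have hp : Continuous p := by
    refine Continuous.smul (Continuous.inv₀ (by fun_prop) fun x => (hm x).ne') continuous_id
  have hp1 : ∀ x, ‖p x‖ ≤ 1 := by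
    intro x
    simp only [p]
    rw [norm_smul, norm_inv, Real.norm_of_nonneg (hm x).le, inv_mul_le_iff₀ (hm x), mul_one]
    exact le_max_right _ _
  have hp2 : ∀ x, ‖x‖ ≤ 1 → p x = x := by
    intro x hx
    simp [p, hx]
  let g : E → E := fun x => (min 1 (max 0 (2 - ‖x‖))) • (h (p x) - p x)
  have hg : Continuous g := by
    refine Continuous.smul (by fun_prop) (Continuous.sub ?_ hp)
    exact hc.comp_continuous hp fun x => by simpa using hp1 x
  obtain ⟨x, hx⟩ := exists_add_eq_zero_of_support_subset (R := 2) two_pos hg fun x hx => by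
    simp [g, hx]
  have hgn : ‖g x‖ ≤ 1 := by
    simp only [g]
    rw [norm_smul]
    refine mul_le_one₀ ?_ (norm_nonneg _) (hh _ (hp1 x))
    rw [Real.norm_of_nonneg (le_min zero_le_one (le_max_left _ _))]
    exact min_le_left _ _
  have hx1 : ‖x‖ ≤ 1 := by
    rw [eq_neg_of_add_eq_zero_left hx, norm_neg]; exact hgn
  refine ⟨x, hx1, ?_⟩
  have h1 : (1 : ℝ) ≤ 2 - ‖x‖ := by linarith
  have h2 : (0 : ℝ) ≤ 2 - ‖x‖ := by linarith
  simpa [g, hp2 x hx1, h1, h2] using hx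

theorem image_closedBall_mem_nhds {E : Type*} [NormedAddCommGroup E]
    [InnerProductSpace ℝ E] [FiniteDimensional ℝ E] {f : E → E}
    (hf : ContinuousOn f (Metric.closedBall 0 1)) (hinj : Set.InjOn f (Metric.closedBall 0 1)) :
    f '' Metric.closedBall 0 1 ∈ nhds (f 0) := by
  borelize E
  set B := Metric.closedBall (0 : E) 1 with hB
  set K := f '' B with hKdef
  have hKc : IsCompact K := (isCompact_closedBall 0 1).image_of_continuousOn hf
  -- a continuous left inverse of `f`, defined on the whole space
  obtain ⟨G, hG⟩ : ∃ G : E → E, Continuous G ∧ ∀ x ∈ B, G (f x) = x := by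
    have hcB : CompactSpace B := isCompact_iff_compactSpace.1 (isCompact_closedBall 0 1)
    have he : Topology.IsClosedEmbedding (B.domRestrict f) :=
      (continuousOn_iff_continuous_domRestrict.1 hf).isClosedEmbedding
        (Set.injOn_iff_injective.1 hinj)
    obtain ⟨G, hG⟩ := ContinuousMap.exists_extension' he
      (⟨Subtype.val, continuous_subtype_val⟩ : C(B, E))
    exact ⟨G, G.continuous, fun x hx => congrFun hG ⟨x, hx⟩⟩
  obtain ⟨hGc, hGf⟩ := hG
  have h0B : (0 : E) ∈ B := by simp [hB]
  obtain ⟨η, hη, hGη⟩ := Metric.continuous_iff.1 hGc (f 0) (1 / 10) (by norm_num)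
  rw [hGf 0 h0B] at hGη
  set ε := η / 3 with hε
  have hε0 : 0 < ε := by positivity
  by_contra hnot
  obtain ⟨c, hcε, hcK⟩ : ∃ c, dist c (f 0) < ε ∧ c ∉ K := by
    by_contra! h
    exact hnot (Metric.mem_nhds_iff.2 ⟨ε, hε0, fun y hy => h y hy⟩)
  have hG1 : ∀ y ∈ K \ Metric.ball c ε, 0 < ‖G y‖ := by
    rintro _ ⟨⟨x, hx, rfl⟩, hy⟩
    rw [hGf x hx, norm_pos_iff]
    rintro rfl
    exact hy (by rwa [Metric.mem_ball, dist_comm])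
  obtain ⟨δ', hδ', hGδ'⟩ :=
    (hKc.diff Metric.isOpen_ball).exists_forall_le' hGc.norm.continuousOn hG1
  set δ := min δ' (1 / 10) with hδ
  have hδ0 : 0 < δ := by positivity
  obtain ⟨Q, hQ, hQG, -⟩ := hGc.exists_contDiff_approx 1 (ε := fun _ => δ / 2) (by fun_prop)
    (fun _ => by positivity)
  obtain ⟨e, heδ, heQ⟩ : ∃ e ∈ Metric.ball (0 : E) (δ / 2), e ∉ Q '' Metric.sphere c ε := by
    by_contra! h
    have h1 : MeasureTheory.volume (Q '' Metric.sphere c ε) = 0 :=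
      MeasureTheory.addHaar_image_eq_zero_of_differentiableOn_of_addHaar_eq_zero _
        (hQ.differentiable one_ne_zero).differentiableOn
        (MeasureTheory.Measure.addHaar_sphere_of_ne_zero _ _ hε0.ne')
    exact (Metric.measure_ball_pos MeasureTheory.volume (0 : E) (half_pos hδ0)).ne'
      (MeasureTheory.measure_mono_null h h1)
  have hQe : ∀ y, ‖Q y - e - G y‖ < δ := by
    intro y
    have h1 := hQG y
    rw [dist_eq_norm] at h1
    rw [mem_ball_zero_iff] at heδ
    calc ‖Q y - e - G y‖ = ‖(Q y - G y) - e‖ := by congr 1; abel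
      _ ≤ ‖Q y - G y‖ + ‖e‖ := norm_sub_le _ _
      _ < δ := by linarith
  let Φ : E → E := fun y => c + (max 1 (ε / ‖y - c‖)) • (y - c)
  have hΦc : ContinuousOn Φ {c}ᶜ := by
    intro y hy
    have : ‖y - c‖ ≠ 0 := norm_ne_zero_iff.2 (sub_ne_zero.2 hy)
    have h1 : ContinuousAt (fun y => ε / ‖y - c‖) y :=
      continuousAt_const.div (by fun_prop) this
    exact (continuousAt_const.add ((continuousAt_const.max h1).smul
      (continuousAt_id.sub continuousAt_const))).continuousWithinAt
  have hΦ1 : ∀ y, ε ≤ ‖y - c‖ → Φ y = y := by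
    intro y hy
    have : ε / ‖y - c‖ ≤ 1 := div_le_one_of_le₀ hy (norm_nonneg _)
    simp [Φ, this]
  have hΦ2 : ∀ y, y ≠ c → ‖y - c‖ < ε → ‖Φ y - c‖ = ε := by
    intro y hy hlt
    have hp : 0 < ‖y - c‖ := norm_pos_iff.2 (sub_ne_zero.2 hy)
    have : 1 ≤ ε / ‖y - c‖ := (one_le_div hp).2 hlt.le
    simp only [Φ, add_sub_cancel_left]
    rw [max_eq_right this, norm_smul, Real.norm_of_nonneg (by positivity), div_mul_cancel₀ _ hp.ne']
  have hfc : ∀ x ∈ B, f x ≠ c := fun x hx h => hcK ⟨x, hx, h⟩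
  obtain ⟨x, hx, hx0⟩ := exists_eq_zero_of_norm_sub_le (h := fun x => Q (Φ (f x)) - e)
    ((hQ.continuous.comp_continuousOn (hΦc.comp hf fun x hx => hfc x hx)).sub continuousOn_const)
    (by
      intro x hx
      have hx' : x ∈ B := by simpa [hB] using hx
      have h10 : δ ≤ 1 / 10 := min_le_right _ _
      rcases le_or_gt ε ‖f x - c‖ with h | h
      · have := hQe (f x)
        rw [hGf x hx'] at this
        rw [hΦ1 _ h]
        linarith
      · have h1 := hΦ2 _ (hfc x hx') h
        have h2 := hGη (Φ (f x)) (by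
          have := dist_triangle (Φ (f x)) c (f 0)
          rw [dist_eq_norm (Φ _) c, h1] at this
          linarith)
        have h3 := hGη (f x) (by
          have := dist_triangle (f x) c (f 0)
          rw [dist_eq_norm (f x) c] at this
          linarith)
        rw [dist_zero_right] at h2 h3
        rw [hGf x hx'] at h3
        have h4 := hQe (Φ (f x))
        calc ‖Q (Φ (f x)) - e - x‖
            = ‖(Q (Φ (f x)) - e - G (Φ (f x))) + G (Φ (f x)) - x‖ := by congr 1; abel
          _ ≤ ‖Q (Φ (f x)) - e - G (Φ (f x))‖ + ‖G (Φ (f x))‖ + ‖x‖ :=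
            (norm_sub_le _ _).trans (by gcongr; exact norm_add_le _ _)
          _ ≤ 1 := by linarith)
  have hx' : x ∈ B := by simpa [hB] using hx
  rcases le_or_gt ε ‖f x - c‖ with h | h
  · have h1 := hQe (f x)
    rw [hΦ1 _ h] at hx0
    rw [hx0, zero_sub, norm_neg] at h1
    have h2 := hGδ' (f x) ⟨⟨x, hx', rfl⟩, by rw [Metric.mem_ball, dist_eq_norm]; exact not_lt.2 h⟩
    have h3 : δ ≤ δ' := min_le_left _ _
    linarith
  · exact heQ ⟨Φ (f x), by rw [mem_sphere_iff_norm]; exact hΦ2 _ (hfc x hx') h, sub_eq_zero.1 hx0⟩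

/-- Brouwer's invariance of domain. -/
theorem image_mem_nhds_of_injOn {E : Type*} [NormedAddCommGroup E]
    [InnerProductSpace ℝ E] [FiniteDimensional ℝ E] {f : E → E} {U : Set E} {x : E}
    (hU : U ∈ nhds x) (hf : ContinuousOn f U) (hinj : Set.InjOn f U) :
    f '' U ∈ nhds (f x) := by
  obtain ⟨ρ, hρ, hρU⟩ := Metric.nhds_basis_closedBall.mem_iff.1 hU
  have hm : Set.MapsTo (fun y : E => x + ρ • y) (Metric.closedBall 0 1) U := by
    intro y hy
    refine hρU ?_
    rw [mem_closedBall_zero_iff] at hy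
    rw [mem_closedBall_iff_norm, add_sub_cancel_left, norm_smul, Real.norm_of_nonneg hρ.le]
    exact mul_le_of_le_one_right hρ.le hy
  have h := image_closedBall_mem_nhds (f := fun y => f (x + ρ • y))
    (hf.comp (by fun_prop) hm) (fun y hy z hz hyz => by
      have := hinj (hm hy) (hm hz) hyz
      exact smul_right_injective E hρ.ne' (add_left_cancel this))
  simp only [smul_zero, add_zero] at h
  refine Filter.mem_of_superset h ?_
  rintro _ ⟨y, hy, rfl⟩
  exact ⟨_, hm hy, rfl⟩

section FlagPseudomanifold

variable {V : Type*} [DecidableEq V]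

open Classical in
/-- The neighbours of `v` in `A`: the vertices of the link of `v`. -/
noncomputable def linkVerts (G : SimpleGraph V) (A : Finset V) (v : V) : Finset V :=
  A.filter (G.Adj v)

open Classical in
/-- The vertices of `A` distinct from `v` and not adjacent to it. -/
noncomputable def nonNbrs (G : SimpleGraph V) (A : Finset V) (v : V) : Finset V :=
  A.filter fun x => x ≠ v ∧ ¬ G.Adj v x

open Classical in
/-- The `f`-polynomial of the clique complex of the subgraph of `G` induced on `A`. -/
noncomputable def cliquePoly (G : SimpleGraph V) (A : Finset V) : ℤ[X] :=
  ∑ F ∈ A.powerset.filter fun F : Finset V => G.IsClique (F : Set V), X ^ #F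

/-- The clique complex of `G` on `A` is a pure complex of dimension `d - 1` in which every
ridge lies in exactly two facets. -/
structure IsFlagPseudomanifold (G : SimpleGraph V) (A : Finset V) (d : ℕ) : Prop where
  card_le : ∀ F ⊆ A, G.IsClique (F : Set V) → #F ≤ d
  exists_extend : ∀ F ⊆ A, G.IsClique (F : Set V) → #F < d → ∀ w,
    ∃ u ∈ A, u ≠ w ∧ u ∉ F ∧ G.IsClique (insert u F : Finset V)
  not_three : ∀ F ⊆ A, G.IsClique (F : Set V) → #F + 1 = d → ∀ T ⊆ A,
    (∀ u ∈ T, u ∉ F ∧ G.IsClique (insert u F : Finset V)) → #T ≤ 2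

variable {G : SimpleGraph V} {A : Finset V} {d : ℕ} {v w x : V}

omit [DecidableEq V] in
theorem mem_linkVerts : x ∈ linkVerts G A v ↔ x ∈ A ∧ G.Adj v x := by simp [linkVerts]

theorem mem_nonNbrs : x ∈ nonNbrs G A v ↔ x ∈ A ∧ x ≠ v ∧ ¬ G.Adj v x := by simp [nonNbrs]

omit [DecidableEq V] in
theorem linkVerts_subset : linkVerts G A v ⊆ A := fun _ h => (mem_linkVerts.1 h).1

theorem isClique_insert_of_subset_linkVerts {F : Finset V} (hF : F ⊆ linkVerts G A v)
    (hc : G.IsClique (F : Set V)) : G.IsClique (insert v F : Finset V) := by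
  rw [coe_insert, SimpleGraph.isClique_insert]
  exact ⟨hc, fun b hb _ => (mem_linkVerts.1 (hF hb)).2⟩

omit [DecidableEq V] in
theorem notMem_of_subset_linkVerts {F : Finset V} (hF : F ⊆ linkVerts G A v) : v ∉ F :=
  fun h => G.irrefl (mem_linkVerts.1 (hF h)).2

theorem card_eq_linkVerts_add_nonNbrs (hv : v ∈ A) :
    #A = #(linkVerts G A v) + #(nonNbrs G A v) + 1 := by
  classical
  have h1 := card_filter_add_card_filter_not (s := A) (G.Adj v)
  have h2 : A.filter (fun x => ¬ G.Adj v x) = insert v (nonNbrs G A v) := by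
    ext x
    by_cases hx : x = v <;> simp [mem_nonNbrs, hx, hv]
  rw [h2, card_insert_of_notMem (by simp [mem_nonNbrs])] at h1
  simp only [linkVerts]
  omega

theorem cliquePoly_eq_erase_add (hv : v ∈ A) :
    cliquePoly G A = cliquePoly G (A.erase v) + X * cliquePoly G (linkVerts G A v) := by
  classical
  unfold cliquePoly
  rw [← sum_filter_add_sum_filter_not _ (fun F => v ∉ F), mul_sum]
  congr 1
  · refine sum_congr ?_ fun _ _ => rfl
    ext F
    simp only [mem_filter, mem_powerset, subset_erase]
    tauto
  · refine (sum_bij' (fun F _ => insert v F) (fun F _ => F.erase v) ?_ ?_ ?_ ?_ ?_).symm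
    · intro F hF
      simp only [mem_filter, mem_powerset, not_not] at hF ⊢
      exact ⟨⟨insert_subset hv (hF.1.trans linkVerts_subset),
        isClique_insert_of_subset_linkVerts hF.1 hF.2⟩, mem_insert_self _ _⟩
    · intro F hF
      simp only [mem_filter, mem_powerset, not_not] at hF ⊢
      refine ⟨fun x hx => mem_linkVerts.2 ⟨hF.1.1 (mem_of_mem_erase hx), ?_⟩,
        hF.1.2.subset (by simp)⟩
      exact hF.1.2 hF.2 (mem_of_mem_erase hx) (ne_of_mem_erase hx).symm
    · intro F hF
      simp only [mem_filter, mem_powerset] at hF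
      exact erase_insert (notMem_of_subset_linkVerts hF.1)
    · intro F hF
      simp only [mem_filter, not_not] at hF
      exact insert_erase hF.2
    · intro F hF
      simp only [mem_filter, mem_powerset] at hF
      rw [card_insert_of_notMem (notMem_of_subset_linkVerts hF.1), pow_succ']

theorem derivative_cliquePoly :
    derivative (cliquePoly G A) = ∑ v ∈ A, cliquePoly G (linkVerts G A v) := by
  classical
  unfold cliquePoly
  rw [derivative_sum]
  calc _ = ∑ F ∈ A.powerset.filter fun F : Finset V => G.IsClique (F : Set V),
          ∑ v ∈ A with v ∈ F, (X : ℤ[X]) ^ (#F - 1) := by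
        refine sum_congr rfl fun F hF => ?_
        rw [mem_filter, mem_powerset] at hF
        rw [derivative_X_pow, sum_const, nsmul_eq_mul, filter_mem_eq_inter,
          inter_eq_right.2 hF.1]
        simp
    _ = ∑ v ∈ A, ∑ F ∈ (A.powerset.filter fun F : Finset V => G.IsClique (F : Set V)) with v ∈ F,
          (X : ℤ[X]) ^ (#F - 1) := by
        simp only [sum_filter (p := fun a => _ ∈ a), sum_filter (s := A)]
        exact sum_comm
    _ = _ := by
        refine sum_congr rfl fun v hv => ?_
        refine (sum_bij' (fun F _ => insert v F) (fun F _ => F.erase v) ?_ ?_ ?_ ?_ ?_).symm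
        · intro F hF
          simp only [mem_filter, mem_powerset] at hF ⊢
          exact ⟨⟨insert_subset hv (hF.1.trans linkVerts_subset),
            isClique_insert_of_subset_linkVerts hF.1 hF.2⟩, mem_insert_self _ _⟩
        · intro F hF
          simp only [mem_filter, mem_powerset] at hF ⊢
          refine ⟨fun x hx => mem_linkVerts.2 ⟨hF.1.1 (mem_of_mem_erase hx), ?_⟩,
            hF.1.2.subset (by simp)⟩
          exact hF.1.2 hF.2 (mem_of_mem_erase hx) (ne_of_mem_erase hx).symm
        · intro F hF
          simp only [mem_filter, mem_powerset] at hF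
          exact erase_insert (notMem_of_subset_linkVerts hF.1)
        · intro F hF
          simp only [mem_filter] at hF
          exact insert_erase hF.2
        · intro F hF
          simp only [mem_filter, mem_powerset] at hF
          rw [card_insert_of_notMem (notMem_of_subset_linkVerts hF.1), Nat.add_sub_cancel]

theorem cliquePoly_coeff_zero : (cliquePoly G A).coeff 0 = 1 := by
  classical
  unfold cliquePoly
  rw [finsetSum_coeff, sum_eq_single ∅]
  · simp
  · intro F _ hF
    rw [coeff_X_pow, if_neg]
    exact fun h => hF (card_eq_zero.1 h.symm)
  · simp

theorem eq_of_derivative_eq_of_coeff_zero_eq {p q : ℤ[X]} (h : derivative p = derivative q)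
    (h0 : p.coeff 0 = q.coeff 0) : p = q := by
  have h1 : derivative (p - q) = 0 := by rw [derivative_sub, h, sub_self]
  have h2 := eq_C_of_natDegree_eq_zero (derivative_eq_zero.1 h1)
  rw [coeff_sub, h0, sub_self, C_0] at h2
  exact sub_eq_zero.1 h2

namespace IsFlagPseudomanifold

theorem link (h : IsFlagPseudomanifold G A (d + 1)) (hv : v ∈ A) :
    IsFlagPseudomanifold G (linkVerts G A v) d := by
  have hsub : ∀ {F}, F ⊆ linkVerts G A v → insert v F ⊆ A := fun hF =>
    insert_subset hv (hF.trans linkVerts_subset)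
  have hcard : ∀ {F}, F ⊆ linkVerts G A v → #(insert v F) = #F + 1 := fun hF =>
    card_insert_of_notMem (notMem_of_subset_linkVerts hF)
  constructor
  · intro F hF hc
    have := h.card_le _ (hsub hF) (isClique_insert_of_subset_linkVerts hF hc)
    rw [hcard hF] at this
    omega
  · intro F hF hc hlt w
    obtain ⟨u, huA, huw, hu, huc⟩ := h.exists_extend _ (hsub hF)
      (isClique_insert_of_subset_linkVerts hF hc) (by rw [hcard hF]; omega) w
    rw [mem_insert, not_or] at hu
    refine ⟨u, mem_linkVerts.2 ⟨huA, ?_⟩, huw, hu.2, huc.subset ?_⟩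
    · exact huc (by simp) (by simp) (Ne.symm hu.1)
    · exact_mod_cast insert_subset_insert u (subset_insert v F)
  · intro F hF hc he T hT hTF
    refine h.not_three _ (hsub hF) (isClique_insert_of_subset_linkVerts hF hc)
      (by rw [hcard hF]; omega) T (hT.trans linkVerts_subset) fun u hu => ?_
    have huL := hT hu
    refine ⟨?_, ?_⟩
    · rw [mem_insert, not_or]
      exact ⟨(mem_linkVerts.1 huL).2.ne', (hTF u hu).1⟩
    · rw [insert_comm]
      exact isClique_insert_of_subset_linkVerts (insert_subset huL hF) (hTF u hu).2

theorem exists_facet (h : IsFlagPseudomanifold G A d) {F : Finset V} (hF : F ⊆ A)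
    (hc : G.IsClique (F : Set V)) (hv : v ∉ F) :
    ∃ F' ⊆ A, F ⊆ F' ∧ G.IsClique (F' : Set V) ∧ v ∉ F' ∧ #F' = d := by
  by_cases hlt : #F < d
  · obtain ⟨u, huA, huw, hu, huc⟩ := h.exists_extend F hF hc hlt v
    have hcard := card_insert_of_notMem hu
    obtain ⟨F', hF', hsub, hrest⟩ := h.exists_facet (F := insert u F) (insert_subset huA hF) huc
      (by rw [mem_insert, not_or]; exact ⟨huw.symm, hv⟩)
    exact ⟨F', hF', (subset_insert u F).trans hsub, hrest⟩
  · exact ⟨F, hF, subset_rfl, hc, hv, le_antisymm (h.card_le F hF hc) (not_lt.1 hlt)⟩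
termination_by d - #F

theorem nonNbrs_nonempty (h : IsFlagPseudomanifold G A d) (hv : v ∈ A) :
    (nonNbrs G A v).Nonempty := by
  by_contra hne
  rw [not_nonempty_iff_eq_empty] at hne
  obtain ⟨F, hF, -, hc, hvF, hcard⟩ := h.exists_facet (F := ∅) (v := v) (by simp) (by simp)
    (by simp)
  have hFL : F ⊆ linkVerts G A v := by
    intro x hx
    have hxv : x ≠ v := fun e => hvF (e ▸ hx)
    by_contra hn
    have : x ∈ nonNbrs G A v :=
      mem_nonNbrs.2 ⟨hF hx, hxv, fun ha => hn (mem_linkVerts.2 ⟨hF hx, ha⟩)⟩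
    simp [hne] at this
  have := h.card_le _ (insert_subset hv hF) (isClique_insert_of_subset_linkVerts hFL hc)
  rw [card_insert_of_notMem hvF] at this
  omega

theorem nonempty [Nonempty V] (h : IsFlagPseudomanifold G A (d + 1)) : A.Nonempty := by
  obtain ⟨u, hu, -⟩ := h.exists_extend ∅ (by simp) (by simp) (by simp) (Classical.arbitrary V)
  exact ⟨u, hu⟩

theorem two_mul_le_card [Nonempty V] (h : IsFlagPseudomanifold G A d) : 2 * d ≤ #A := by
  induction d generalizing A with
  | zero => simp
  | succ d ih =>
    obtain ⟨v, hv⟩ := h.nonempty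
    have h1 := ih (h.link hv)
    have h2 := (h.nonNbrs_nonempty hv).card_pos
    have h3 := card_eq_linkVerts_add_nonNbrs (G := G) hv
    omega

theorem card_eq_zero (h : IsFlagPseudomanifold G A 0) : A = ∅ := by
  refine eq_empty_of_forall_notMem fun v hv => ?_
  have := h.card_le {v} (by simpa using hv) (by simp)
  simp at this

theorem card_eq_two [Nonempty V] (h : IsFlagPseudomanifold G A 1) : #A = 2 :=
  le_antisymm (h.not_three ∅ (by simp) (by simp) (by simp) A subset_rfl fun u _ => by simp)
    h.two_mul_le_card

theorem card_nonNbrs_bounds (h : IsFlagPseudomanifold G A (d + 1)) (hv : v ∈ A) :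
    1 ≤ #(nonNbrs G A v) ∧ 2 * d + 1 + #(nonNbrs G A v) ≤ #A := by
  have : Nonempty V := ⟨v⟩
  have h1 := (h.link hv).two_mul_le_card
  have h2 := (h.nonNbrs_nonempty hv).card_pos
  have h3 := card_eq_linkVerts_add_nonNbrs (G := G) hv
  omega

theorem adj_of_nonNbrs_eq_singleton (h : IsFlagPseudomanifold G A (d + 1)) (hv : v ∈ A)
    (hw : nonNbrs G A v = {w}) (hx : x ∈ linkVerts G A v) : G.Adj w x := by
  obtain ⟨F, hF, hxF, hc, -, hcard⟩ := (h.link hv).exists_facet (F := {x}) (v := v)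
    (by simpa using hx) (by simp) (by simpa using (mem_linkVerts.1 hx).2.ne)
  obtain ⟨u, huA, huv, huF, huc⟩ := h.exists_extend F (hF.trans linkVerts_subset) hc (by omega) v
  have huL : u ∉ linkVerts G A v := by
    intro huL
    have hsub : insert u F ⊆ linkVerts G A v := insert_subset huL hF
    have := (h.link hv).card_le _ hsub huc
    rw [card_insert_of_notMem huF] at this
    omega
  have : u ∈ nonNbrs G A v := mem_nonNbrs.2 ⟨huA, huv, fun ha => huL (mem_linkVerts.2 ⟨huA, ha⟩)⟩
  rw [hw, mem_singleton] at this
  subst this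
  have hxF' : x ∈ F := hxF (by simp)
  exact huc (by simp) (by simp [hxF']) fun e => huF (e ▸ hxF')

theorem exists_suspension (h : IsFlagPseudomanifold G A (d + 1)) (hv : v ∈ A)
    (h1 : #(nonNbrs G A v) = 1) : #A = #(linkVerts G A v) + 2 ∧
    cliquePoly G A = (1 + 2 * X) * cliquePoly G (linkVerts G A v) ∧
    ∑ x ∈ A, #(nonNbrs G A x) = ∑ x ∈ linkVerts G A v, #(nonNbrs G (linkVerts G A v) x) + 2 := by
  obtain ⟨w, hw⟩ := Finset.card_eq_one.1 h1
  set L := linkVerts G A v with hL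
  have hwA := mem_nonNbrs.1 (hw ▸ mem_singleton_self w : w ∈ nonNbrs G A v)
  have hvL : v ∉ L := notMem_of_subset_linkVerts subset_rfl
  have hwL : w ∉ L := fun hx => hwA.2.2 (mem_linkVerts.1 hx).2
  have hadj : ∀ x ∈ L, G.Adj w x := fun x hx => h.adj_of_nonNbrs_eq_singleton hv hw hx
  have hmem : ∀ x ∈ A, x ∉ L → x = v ∨ x = w := by
    intro x hx hxL
    by_contra! hne
    have : x ∈ nonNbrs G A v := mem_nonNbrs.2 ⟨hx, hne.1, fun ha => hxL (mem_linkVerts.2 ⟨hx, ha⟩)⟩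
    rw [hw, mem_singleton] at this
    exact hne.2 this
  have hA : A = insert v (insert w L) := by
    ext x
    simp only [mem_insert]
    constructor
    · intro hx
      have := hmem x hx
      tauto
    · rintro (rfl | rfl | hx)
      exacts [hv, hwA.1, linkVerts_subset hx]
  have hvwL : v ∉ insert w L := by simp [hwA.2.1.symm, hvL]
  have herase : A.erase v = insert w L := by rw [hA, erase_insert hvwL]
  have hlinkw : linkVerts G (insert w L) w = L := by
    ext x
    rw [mem_linkVerts, mem_insert]
    constructor
    · rintro ⟨rfl | hx, ha⟩
      exacts [(G.irrefl ha).elim, hx]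
    · exact fun hx => ⟨Or.inr hx, hadj x hx⟩
  have hMw : nonNbrs G A w = {v} := by
    ext x
    rw [mem_nonNbrs, mem_singleton]
    constructor
    · rintro ⟨hx, hxw, ha⟩
      by_contra hxv
      have := hmem x hx fun hxL => ha (hadj x hxL)
      tauto
    · rintro rfl
      exact ⟨hv, hwA.2.1.symm, fun ha => hwA.2.2 ha.symm⟩
  have hMx : ∀ x ∈ L, nonNbrs G A x = nonNbrs G L x := by
    intro x hx
    ext y
    rw [mem_nonNbrs, mem_nonNbrs]
    constructor
    · rintro ⟨hy, hyx, ha⟩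
      refine ⟨?_, hyx, ha⟩
      by_contra hyL
      rcases hmem y hy hyL with rfl | rfl
      · exact ha (mem_linkVerts.1 hx).2.symm
      · exact ha (hadj x hx).symm
    · rintro ⟨hy, hrest⟩
      exact ⟨linkVerts_subset hy, hrest⟩
  refine ⟨?_, ?_, ?_⟩
  · rw [hA, card_insert_of_notMem hvwL, card_insert_of_notMem hwL]
  · rw [cliquePoly_eq_erase_add hv, herase, cliquePoly_eq_erase_add (mem_insert_self w L),
      erase_insert hwL, hlinkw]
    ring
  · have : ∀ s : Finset V, s = insert v (insert w L) → ∑ x ∈ s, #(nonNbrs G A x) =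
        #(nonNbrs G A v) + (#(nonNbrs G A w) + ∑ x ∈ L, #(nonNbrs G A x)) := by
      rintro s rfl
      rw [sum_insert hvwL, sum_insert hwL]
    rw [this A hA, hw, hMw, sum_congr rfl fun x hx => by rw [hMx x hx]]
    simp only [card_singleton]
    omega

end IsFlagPseudomanifold

theorem sum_card_nonNbrs_link_le (hv : v ∈ A) :
    ∑ x ∈ linkVerts G A v, #(nonNbrs G A x) + #(nonNbrs G A v) ≤
      ∑ x ∈ linkVerts G A v, #(nonNbrs G (linkVerts G A v) x) +
        ∑ a ∈ nonNbrs G A v, #(nonNbrs G A a) := by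
  classical
  set L := linkVerts G A v
  set M := nonNbrs G A v
  let r : V → V → Prop := fun x a => x ≠ a ∧ ¬ G.Adj x a
  have hdc := sum_card_bipartiteAbove_eq_sum_card_bipartiteBelow (s := L) (t := M) r
  have h1 : ∀ x ∈ L, #(nonNbrs G A x) ≤ #(nonNbrs G L x) + #(bipartiteAbove r M x) := by
    intro x hx
    refine (card_le_card fun y hy => ?_).trans (card_union_le _ _)
    rw [mem_nonNbrs] at hy
    rw [mem_union, mem_nonNbrs, mem_bipartiteAbove]
    by_cases hyL : y ∈ L
    · exact Or.inl ⟨hyL, hy.2⟩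
    · refine Or.inr ⟨mem_nonNbrs.2 ⟨hy.1, ?_, fun ha => hyL (mem_linkVerts.2 ⟨hy.1, ha⟩)⟩,
        hy.2.1.symm, hy.2.2⟩
      rintro rfl
      exact hy.2.2 (mem_linkVerts.1 hx).2.symm
  have h2 : ∀ a ∈ M, #(bipartiteBelow r L a) + 1 ≤ #(nonNbrs G A a) := by
    intro a ha
    have hav := mem_nonNbrs.1 ha
    have hvn : v ∉ bipartiteBelow r L a := fun hm =>
      notMem_of_subset_linkVerts subset_rfl (mem_bipartiteBelow _ |>.1 hm).1
    rw [← card_insert_of_notMem hvn]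
    refine card_le_card fun y hy => ?_
    rw [mem_insert, mem_bipartiteBelow] at hy
    rw [mem_nonNbrs]
    rcases hy with rfl | ⟨hyL, hya, hadj⟩
    · exact ⟨hv, hav.2.1.symm, fun h => hav.2.2 h.symm⟩
    · exact ⟨linkVerts_subset hyL, hya, fun h => hadj h.symm⟩
  have h3 := sum_le_sum h1
  have h4 := sum_le_sum h2
  simp only [sum_add_distrib, sum_const, smul_eq_mul, mul_one] at h3 h4
  omega

namespace IsFlagPseudomanifold

theorem cliquePoly_of_card_eq_two_mul (h : IsFlagPseudomanifold G A d) (hA : #A = 2 * d) :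
    cliquePoly G A = (1 + 2 * X) ^ d ∧ ∑ x ∈ A, #(nonNbrs G A x) = 2 * d := by
  induction d generalizing A with
  | zero =>
    rw [h.card_eq_zero]
    simp [cliquePoly, filter_singleton]
  | succ d ih =>
    obtain ⟨v, hv⟩ : A.Nonempty := card_pos.1 (by omega)
    have hb := h.card_nonNbrs_bounds hv
    obtain ⟨h1, h2, h3⟩ := h.exists_suspension hv (by omega)
    obtain ⟨h4, h5⟩ := ih (h.link hv) (by omega)
    exact ⟨by rw [h2, h4, pow_succ'], by omega⟩

theorem derivative_cliquePoly_eq_nsmul {p : ℤ[X]}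
    (hp : ∀ v ∈ A, cliquePoly G (linkVerts G A v) = p) :
    derivative (cliquePoly G A) = #A * p := by
  rw [derivative_cliquePoly, sum_congr rfl hp, sum_const, nsmul_eq_mul]

theorem cliquePoly_of_card_eq_two_mul_add_one (h : IsFlagPseudomanifold G A d)
    (hA : #A = 2 * d + 1) :
    2 ≤ d ∧ cliquePoly G A = (1 + 2 * X) ^ d + X * (1 + X) * (1 + 2 * X) ^ (d - 2) ∧
      ∑ x ∈ A, #(nonNbrs G A x) ≤ 2 * d + 6 := by
  induction d generalizing A with
  | zero => simp [h.card_eq_zero] at hA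
  | succ d ih =>
    obtain ⟨v, hv⟩ : A.Nonempty := card_pos.1 (by omega)
    have : Nonempty V := ⟨v⟩
    by_cases hex : ∃ v ∈ A, #(nonNbrs G A v) = 1
    · obtain ⟨v, hv, h1⟩ := hex
      obtain ⟨h1, h2, h3⟩ := h.exists_suspension hv h1
      obtain ⟨h4, h5, h6⟩ := ih (h.link hv) (by omega)
      refine ⟨by omega, ?_, by omega⟩
      obtain ⟨e, rfl⟩ := Nat.exists_eq_add_of_le' h4
      rw [h2, h5, Nat.add_sub_cancel, show e + 2 + 1 - 2 = e + 1 by omega]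
      ring
    · have hM : ∀ x ∈ A, #(nonNbrs G A x) = 2 := by
        intro x hx
        have := h.card_nonNbrs_bounds hx
        have : #(nonNbrs G A x) ≠ 1 := fun e => hex ⟨x, hx, e⟩
        omega
      have hL : ∀ x ∈ A, #(linkVerts G A x) = 2 * d := fun x hx => by
        have := card_eq_linkVerts_add_nonNbrs (G := G) hx
        have := hM x hx
        omega
      have h1 := sum_card_nonNbrs_link_le (G := G) hv
      rw [((h.link hv).cliquePoly_of_card_eq_two_mul (hL v hv)).2, hM v hv,
        sum_congr rfl fun x hx => hM x (linkVerts_subset hx),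
        sum_congr rfl fun x hx => hM x (mem_nonNbrs.1 hx).1] at h1
      simp only [sum_const, smul_eq_mul, hM v hv, hL v hv] at h1
      have hd : d ≠ 0 := by
        rintro rfl
        have := h.card_eq_two
        omega
      obtain rfl : d = 1 := by omega
      refine ⟨le_rfl, ?_, ?_⟩
      · refine eq_of_derivative_eq_of_coeff_zero_eq ?_ ?_
        · rw [derivative_cliquePoly_eq_nsmul fun x hx =>
            ((h.link hx).cliquePoly_of_card_eq_two_mul (hL x hx)).1, hA]
          simp [derivative_pow]
          ring
        · rw [cliquePoly_coeff_zero]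
          simp [coeff_zero_eq_eval_zero]
      · rw [sum_congr rfl hM, sum_const, hA]
        simp

theorem cliquePoly_of_card_eq_two_mul_add_two (h : IsFlagPseudomanifold G A d)
    (hA : #A = 2 * d + 2) :
    2 ≤ d ∧ (cliquePoly G A = (1 + 2 * X) ^ d + 2 * (X * (1 + X)) * (1 + 2 * X) ^ (d - 2) ∨
      4 ≤ d ∧ cliquePoly G A = (1 + 2 * X) ^ d + 2 * (X * (1 + X)) * (1 + 2 * X) ^ (d - 2) +
        (X * (1 + X)) ^ 2 * (1 + 2 * X) ^ (d - 4)) := by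
  induction d generalizing A with
  | zero => simp [h.card_eq_zero] at hA
  | succ d ih =>
    obtain ⟨v, hv⟩ : A.Nonempty := card_pos.1 (by omega)
    have : Nonempty V := ⟨v⟩
    by_cases hex : ∃ v ∈ A, #(nonNbrs G A v) = 1
    · obtain ⟨v, hv, h1⟩ := hex
      obtain ⟨h1, h2, -⟩ := h.exists_suspension hv h1
      obtain ⟨h4, h5⟩ := ih (h.link hv) (by omega)
      refine ⟨by omega, ?_⟩
      rw [h2]
      rcases h5 with h5 | ⟨h4, h5⟩
      · left
        obtain ⟨e, rfl⟩ := Nat.exists_eq_add_of_le' h4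
        rw [h5, Nat.add_sub_cancel, show e + 2 + 1 - 2 = e + 1 by omega]
        ring
      · refine Or.inr ⟨by omega, ?_⟩
        obtain ⟨e, rfl⟩ := Nat.exists_eq_add_of_le' h4
        rw [h5, Nat.add_sub_cancel, show e + 4 + 1 - 2 = e + 3 by omega,
          show e + 4 - 2 = e + 2 by omega, show e + 4 + 1 - 4 = e + 1 by omega]
        ring
    · have hM : ∀ x ∈ A, #(nonNbrs G A x) = 2 ∨ #(nonNbrs G A x) = 3 := by
        intro x hx
        have := h.card_nonNbrs_bounds hx
        have : #(nonNbrs G A x) ≠ 1 := fun e => hex ⟨x, hx, e⟩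
        omega
      have hL : ∀ x ∈ A, #(linkVerts G A x) + #(nonNbrs G A x) = 2 * d + 3 := fun x hx => by
        have := card_eq_linkVerts_add_nonNbrs (G := G) hx
        omega
      have hd : d ≠ 0 := by
        rintro rfl
        have := h.card_eq_two
        omega
      have link3 : ∀ x ∈ A, #(nonNbrs G A x) = 3 →
          cliquePoly G (linkVerts G A x) = (1 + 2 * X) ^ d ∧
          ∑ y ∈ linkVerts G A x, #(nonNbrs G (linkVerts G A x) y) = 2 * d := fun x hx h3 =>
        (h.link hx).cliquePoly_of_card_eq_two_mul (by have := hL x hx; omega)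
      have link2 : ∀ x ∈ A, #(nonNbrs G A x) = 2 →
          2 ≤ d ∧ cliquePoly G (linkVerts G A x) =
            (1 + 2 * X) ^ d + X * (1 + X) * (1 + 2 * X) ^ (d - 2) ∧
          ∑ y ∈ linkVerts G A x, #(nonNbrs G (linkVerts G A x) y) ≤ 2 * d + 6 := fun x hx h2 =>
        (h.link hx).cliquePoly_of_card_eq_two_mul_add_one (by have := hL x hx; omega)
      have hlow : ∀ x ∈ A, 2 * #(linkVerts G A x) ≤ ∑ y ∈ linkVerts G A x, #(nonNbrs G A y) := by
        intro x hx
        rw [mul_comm, ← smul_eq_mul]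
        refine card_nsmul_le_sum _ _ _ fun y hy => ?_
        have := hM y (linkVerts_subset hy)
        omega
      have hupp : ∀ x ∈ A, ∑ a ∈ nonNbrs G A x, #(nonNbrs G A a) ≤ 3 * #(nonNbrs G A x) := by
        intro x hx
        rw [mul_comm, ← smul_eq_mul]
        refine sum_le_card_nsmul _ _ _ fun y hy => ?_
        have := hM y (mem_nonNbrs.1 hy).1
        omega
      have hdeg3 : ∀ x ∈ A, #(nonNbrs G A x) = 3 → d ≤ 3 := by
        intro x hx h3
        have := sum_card_nonNbrs_link_le (G := G) hx
        have := hlow x hx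
        have := hupp x hx
        have := hL x hx
        have := (link3 x hx h3).2
        omega
      have hall2 : (∀ x ∈ A, #(nonNbrs G A x) = 2) → d ≤ 3 := by
        intro hall
        have := sum_card_nonNbrs_link_le (G := G) hv
        have := hlow v hv
        have := hL v hv
        have := (link2 v hv (hall v hv)).2.2
        have h4 : ∑ a ∈ nonNbrs G A v, #(nonNbrs G A a) = ∑ a ∈ nonNbrs G A v, 2 :=
          sum_congr rfl fun a ha => hall a (mem_nonNbrs.1 ha).1
        simp only [sum_const, smul_eq_mul, hall v hv] at h4
        have := hall v hv
        omega
      have hd3 : d ≤ 3 := by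
        by_cases hall : ∀ x ∈ A, #(nonNbrs G A x) = 2
        · exact hall2 hall
        · push Not at hall
          obtain ⟨x, hx, hne⟩ := hall
          exact hdeg3 x hx ((hM x hx).resolve_left hne)
      refine ⟨by omega, ?_⟩
      interval_cases d
      · exact absurd rfl hd
      · left
        refine eq_of_derivative_eq_of_coeff_zero_eq ?_ ?_
        · rw [derivative_cliquePoly_eq_nsmul (p := (1 + 2 * X) ^ 1), hA]
          · simp [derivative_pow]
            ring
          · intro x hx
            refine (link3 x hx ((hM x hx).resolve_left fun h2 => ?_)).1
            have := (link2 x hx h2).1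
            omega
        · rw [cliquePoly_coeff_zero]
          simp [coeff_zero_eq_eval_zero]
      · left
        have hder : derivative (cliquePoly G A) = 8 * (1 + 2 * X) ^ 2 +
            (#{x ∈ A | #(nonNbrs G A x) = 2} : ℤ[X]) * (X * (1 + X)) := by
          have : ∀ x ∈ A, cliquePoly G (linkVerts G A x) = (1 + 2 * X) ^ 2 +
              if #(nonNbrs G A x) = 2 then X * (1 + X) else 0 := by
            intro x hx
            split_ifs with h2
            · rw [(link2 x hx h2).2.1]
              simp
            · rw [(link3 x hx ((hM x hx).resolve_left h2)).1, add_zero]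
          rw [derivative_cliquePoly, sum_congr rfl this, sum_add_distrib, ← sum_filter,
            sum_const, sum_const, hA]
          simp
        have hn := card_filter_le A fun x => #(nonNbrs G A x) = 2
        set n := #{x ∈ A | #(nonNbrs G A x) = 2}
        have hder' : derivative (cliquePoly G A) =
            C 8 + C (32 + (n : ℤ)) * X ^ 1 + C (32 + (n : ℤ)) * X ^ 2 := by
          rw [hder]
          simp
          ring
        have e1 := congrArg (fun p => coeff p 1) hder'
        have e2 := congrArg (fun p => coeff p 2) hder'
        simp only [coeff_derivative, coeff_add, coeff_C_mul, coeff_X_pow, coeff_C] at e1 e2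
        norm_num at e1 e2
        have hn4 : n = 4 := by omega
        refine eq_of_derivative_eq_of_coeff_zero_eq ?_ ?_
        · rw [hder, hn4]
          simp [derivative_pow]
          ring
        · rw [cliquePoly_coeff_zero]
          simp [coeff_zero_eq_eval_zero]
      · right
        refine ⟨le_rfl, ?_⟩
        have heq : ∀ x ∈ A, #(nonNbrs G A x) = 3 →
            (∀ a ∈ nonNbrs G A x, #(nonNbrs G A a) = 3) ∧
              ∀ y ∈ linkVerts G A x, #(nonNbrs G A y) = 2 := by
          intro x hx h3
          have h1 := sum_card_nonNbrs_link_le (G := G) hx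
          have h4 := hlow x hx
          have h5 := hupp x hx
          have h6 := hL x hx
          have h7 := (link3 x hx h3).2
          constructor
          · intro a ha
            refine (sum_eq_sum_iff_of_le (f := fun a => #(nonNbrs G A a)) (g := fun _ => 3)
              fun a ha => ?_).1 ?_ a ha
            · have := hM a (mem_nonNbrs.1 ha).1
              omega
            · simp only [sum_const, smul_eq_mul]
              omega
          · intro y hy
            refine ((sum_eq_sum_iff_of_le (f := fun _ => 2) (g := fun a => #(nonNbrs G A a))
              fun a ha => ?_).1 ?_ y hy).symm
            · have := hM a (linkVerts_subset ha)
              omega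
            · simp only [sum_const, smul_eq_mul]
              omega
        have hall : ∀ x ∈ A, #(nonNbrs G A x) = 2 := by
          intro x hx
          refine (hM x hx).resolve_right fun h3 => ?_
          obtain ⟨hx3, hx2⟩ := heq x hx h3
          have hsub : ∀ y ∈ linkVerts G A x, nonNbrs G A y ⊆ nonNbrs G (linkVerts G A x) y := by
            intro y hy a ha
            obtain ⟨haA, hay, hadj⟩ := mem_nonNbrs.1 ha
            refine mem_nonNbrs.2 ⟨mem_linkVerts.2 ⟨haA, ?_⟩, hay, hadj⟩
            by_contra hxa
            have hax : a ≠ x := by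
              rintro rfl
              exact hadj (mem_linkVerts.1 hy).2.symm
            have ha3 := hx3 a (mem_nonNbrs.2 ⟨haA, hax, hxa⟩)
            have hy3 := (heq a haA ha3).1 y
              (mem_nonNbrs.2 ⟨linkVerts_subset hy, hay.symm, fun h => hadj h.symm⟩)
            have := hx2 y hy
            omega
          have h1 := sum_le_sum fun y hy => card_le_card (hsub y hy)
          have h2 := hlow x hx
          have h4 := hL x hx
          have h5 := (link3 x hx h3).2
          omega
        refine eq_of_derivative_eq_of_coeff_zero_eq ?_ ?_
        · rw [derivative_cliquePoly_eq_nsmul fun x hx => (link2 x hx (hall x hx)).2.1, hA]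
          simp [derivative_pow]
          ring
        · rw [cliquePoly_coeff_zero]
          simp [coeff_zero_eq_eval_zero]

end IsFlagPseudomanifold

end FlagPseudomanifold

section Realization

theorem exists_chart_of_homeomorph_sphere {X : Type*} [TopologicalSpace X] {m : ℕ}
    (h : X ≃ₜ Metric.sphere (0 : EuclideanSpace ℝ (Fin (m + 1))) 1) (x : X) :
    ∃ e : OpenPartialHomeomorph X (EuclideanSpace ℝ (Fin m)), x ∈ e.source := by
  have : Fact (Module.finrank ℝ (EuclideanSpace ℝ (Fin (m + 1))) = m + 1) := ⟨by simp⟩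
  exact ⟨h.toOpenPartialHomeomorph.trans (chartAt (EuclideanSpace ℝ (Fin m)) (h x)), by simp⟩

section Charts

variable {α E : Type*} [TopologicalSpace α] [NormedAddCommGroup E] [InnerProductSpace ℝ E]
  [FiniteDimensional ℝ E] {R : Set α}

open Topology

theorem image_mem_nhds_of_injOn_of_chart {e : OpenPartialHomeomorph R E} {x : R}
    (hx : x ∈ e.source) {W : Set α} (hW : W ∈ 𝓝[R] (x : α)) {g : α → E}
    (hg : ContinuousOn g W) (hinj : Set.InjOn g W) : g '' W ∈ 𝓝 (g x) := by
  have hU : e.target ∩ e.symm ⁻¹' (Subtype.val ⁻¹' W) ∈ 𝓝 (e x) := by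
    refine Filter.inter_mem (e.open_target.mem_nhds (e.map_source hx)) ?_
    refine (e.continuousAt_symm (e.map_source hx)).preimage_mem_nhds ?_
    rw [e.left_inv hx]
    exact preimage_coe_mem_nhds_subtype.2 hW
  have key := image_mem_nhds_of_injOn hU (f := fun z => g (e.symm z))
    (hg.comp (continuous_subtype_val.comp_continuousOn
      (e.continuousOn_symm.mono Set.inter_subset_left)) fun z hz => hz.2)
    fun a ha b hb hab => e.symm.injOn ha.1 hb.1 (Subtype.ext (hinj ha.2 hb.2 hab))
  rw [e.left_inv hx] at key
  refine Filter.mem_of_superset key ?_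
  rintro _ ⟨z, hz, rfl⟩
  exact ⟨_, hz.2, rfl⟩

theorem image_mem_nhdsWithin_of_injOn_of_chart {f : E → α} {y : E} (hy : f y ∈ R)
    {e : OpenPartialHomeomorph R E} (hye : ⟨f y, hy⟩ ∈ e.source) {V : Set E} (hV : V ∈ 𝓝 y)
    (hVR : Set.MapsTo f V R) (hf : ContinuousOn f V) (hinj : Set.InjOn f V) :
    f '' V ∈ 𝓝[R] (f y) := by
  classical
  let F : E → R := fun z => if h : f z ∈ R then ⟨f z, h⟩ else ⟨f y, hy⟩
  have hF : ∀ z ∈ V, (F z : α) = f z := fun z hz => by simp [F, hVR hz]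
  have hFy : F y = ⟨f y, hy⟩ := by simp [F, hy]
  have hFc : ContinuousOn F V := IsInducing.subtypeVal.continuousOn_iff.2 (hf.congr hF)
  have hU : V ∩ F ⁻¹' e.source ∈ 𝓝 y := Filter.inter_mem hV
    ((hFc.continuousAt hV).preimage_mem_nhds (by rw [hFy]; exact e.open_source.mem_nhds hye))
  have key := image_mem_nhds_of_injOn hU (f := fun z => e (F z))
    (e.continuousOn.comp (hFc.mono Set.inter_subset_left) fun z hz => hz.2)
    fun a ha b hb hab => hinj ha.1 hb.1 (by
      rw [← hF a ha.1, ← hF b hb.1, e.injOn ha.2 hb.2 hab])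
  rw [hFy] at key
  have h2 := Filter.inter_mem ((e.continuousAt hye).preimage_mem_nhds key)
    (e.open_source.mem_nhds hye)
  rw [← map_nhds_subtype_val ⟨f y, hy⟩, Filter.mem_map]
  refine Filter.mem_of_superset h2 ?_
  rintro r ⟨⟨z, hz, hzr⟩, hr⟩
  exact ⟨z, hz.1, by rw [← hF z hz.1, e.injOn hz.2 hr hzr]⟩

end Charts

section Realize

variable {N m : ℕ} {Δ : Finset (Finset (Fin N))}

open Topology

theorem exists_notMem_insert_of_chart
    (hchart : ∀ x : realize Δ, ∃ e : OpenPartialHomeomorph (realize Δ) (EuclideanSpace ℝ (Fin m)),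
      x ∈ e.source)
    {G : Finset (Fin N)} (hG : G ∈ Δ) (hne : G.Nonempty) (hcard : #G ≤ m) (w : Fin N) :
    ∃ F ∈ Δ, G ⊆ F ∧ ¬ F ⊆ insert w G := by
  by_contra! hcon
  have hc0 : (0 : ℝ) < #G := by exact_mod_cast hne.card_pos
  let x₀ : Fin N → ℝ := fun v => if v ∈ G then (#G : ℝ)⁻¹ else 0
  have hx₀ : x₀ ∈ realize Δ := by
    refine ⟨G, hG, fun v => ?_, fun v hv => ?_, ?_⟩
    · simp only [x₀]; split_ifs <;> positivity
    · by_contra h; simp [x₀, h] at hv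
    · simp [x₀, sum_ite_mem, hc0.ne']
  let W : Set (Fin N → ℝ) := realize Δ ∩ {x | ∀ v ∈ G, 0 < x v}
  have hW : W ∈ 𝓝[realize Δ] x₀ := by
    refine Filter.inter_mem self_mem_nhdsWithin (mem_nhdsWithin_of_mem_nhds ?_)
    refine IsOpen.mem_nhds ?_ fun v hv => by simp [x₀, hv, hc0]
    simp only [Set.ofPred_forall]
    exact isOpen_biInter_finset fun v _ => isOpen_lt continuous_const (continuous_apply v)
  have hWs : ∀ x ∈ W, ∀ v, v ∉ insert w G → x v = 0 := by
    rintro x ⟨⟨F, hF, -, hs, -⟩, hx⟩ v hv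
    by_contra h
    exact hv (hcon F hF (fun u hu => hs u (hx u hu).ne') (hs v h))
  have hWsum : ∀ x ∈ W, ∑ v, x v = 1 := by
    rintro x ⟨⟨F, hF, -, -, hs⟩, -⟩
    exact hs
  obtain ⟨ι⟩ : Nonempty (G ↪ Fin m) := Function.Embedding.nonempty_of_card_le (by simpa using hcard)
  let g : (Fin N → ℝ) → EuclideanSpace ℝ (Fin m) := fun x =>
    WithLp.toLp 2 fun i => ∑ v : G, if ι v = i then x v else 0
  have hgι : ∀ x (v : G), g x (ι v) = x v := by
    intro x v
    simp only [g, ι.injective.eq_iff]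
    simp
  have hg : Continuous g := by
    refine (PiLp.continuous_toLp 2 _).comp (continuous_pi fun i => ?_)
    refine continuous_finsetSum _ fun v _ => ?_
    split_ifs <;> fun_prop
  have hinj : Set.InjOn g W := by
    intro x hx y hy hxy
    have hG : ∀ v ∈ G, x v = y v := fun v hv => by
      rw [← hgι x ⟨v, hv⟩, ← hgι y ⟨v, hv⟩, hxy]
    have hne : ∀ v, v ≠ w → x v = y v := by
      intro v hv
      by_cases hvG : v ∈ G
      · exact hG v hvG
      · have : v ∉ insert w G := by simp [hv, hvG]
        rw [hWs x hx v this, hWs y hy v this]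
    funext v
    rcases eq_or_ne v w with rfl | hv
    · have h1 := (hWsum x hx).trans (hWsum y hy).symm
      rw [← add_sum_erase _ _ (mem_univ v), ← add_sum_erase _ y (mem_univ v),
        sum_congr rfl fun u hu => hne u (ne_of_mem_erase hu)] at h1
      exact add_right_cancel h1
    · exact hne v hv
  obtain ⟨e, he⟩ := hchart ⟨x₀, hx₀⟩
  have key := image_mem_nhds_of_injOn_of_chart he hW hg.continuousOn hinj
  obtain ⟨v₀, hv₀⟩ := hne
  have hlim : Filter.Tendsto (fun t : ℝ => g x₀ + t • EuclideanSpace.single (ι ⟨v₀, hv₀⟩) (1 : ℝ))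
      (𝓝[>] 0) (𝓝 (g x₀)) := by
    have : ContinuousAt
        (fun t : ℝ => g x₀ + t • EuclideanSpace.single (ι ⟨v₀, hv₀⟩) (1 : ℝ)) 0 := by fun_prop
    simpa using this.tendsto.mono_left nhdsWithin_le_nhds
  obtain ⟨t, ⟨x, hx, hxt⟩, ht⟩ := ((hlim.eventually key).and self_mem_nhdsWithin).exists
  have hxv : ∀ v ∈ G, x v = x₀ v + if v = v₀ then t else 0 := by
    intro v hv
    rw [← hgι x ⟨v, hv⟩, hxt, ← hgι x₀ ⟨v, hv⟩]
    simp [ι.injective.eq_iff]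
  have h1 : ∑ v ∈ G, x v = 1 + t := by
    rw [sum_congr rfl hxv, sum_add_distrib]
    simp [x₀, hv₀, hc0.ne']
  have h2 : ∑ v ∈ G, x v ≤ ∑ v, x v := by
    obtain ⟨⟨F, -, h0, -, -⟩, -⟩ := hx
    exact sum_le_sum_of_subset_of_nonneg (subset_univ G) fun v _ _ => h0 v
  rw [h1, hWsum x hx] at h2
  have : (0 : ℝ) < t := ht
  linarith

theorem not_three_insert_mem_of_chart
    (hchart : ∀ x : realize Δ, ∃ e : OpenPartialHomeomorph (realize Δ) (EuclideanSpace ℝ (Fin m)),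
      x ∈ e.source)
    {G : Finset (Fin N)} (hne : G.Nonempty) (hcard : #G = m) {w₁ w₂ w₃ : Fin N}
    (h12 : w₁ ≠ w₂) (h13 : w₁ ≠ w₃) (h23 : w₂ ≠ w₃) (h1 : w₁ ∉ G) (h2 : w₂ ∉ G) (h3 : w₃ ∉ G)
    (hf1 : insert w₁ G ∈ Δ) (hf2 : insert w₂ G ∈ Δ) : insert w₃ G ∉ Δ := by
  intro hf3
  have hc0 : (0 : ℝ) < #G := by exact_mod_cast hne.card_pos
  obtain ⟨g₀, hg₀⟩ := hne
  have hg1 : g₀ ≠ w₁ := fun e => h1 (e ▸ hg₀)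
  have hg2 : g₀ ≠ w₂ := fun e => h2 (e ▸ hg₀)
  have hg3 : g₀ ≠ w₃ := fun e => h3 (e ▸ hg₀)
  let ι : G ≃ Fin m := G.equivFinOfCardEq hcard
  set i₀ : Fin m := ι ⟨g₀, hg₀⟩ with hi₀
  let q : EuclideanSpace ℝ (Fin m) → Fin N → ℝ := fun y v =>
    if v = w₁ then max (y i₀) 0 else if v = w₂ then max (-y i₀) 0 else
      if h : v ∈ G then y (ι ⟨v, h⟩) else 0
  let f : EuclideanSpace ℝ (Fin m) → Fin N → ℝ := fun y =>
    Function.update (q y) g₀ (1 - ∑ v ∈ univ \ {g₀}, q y v)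
  have hq : Continuous q := by
    refine continuous_pi fun v => ?_
    simp only [q]
    split_ifs <;> fun_prop
  have hf : Continuous f := by
    refine hq.update g₀ (continuous_const.sub (continuous_finsetSum _ fun v _ => ?_))
    exact (continuous_apply v).comp hq
  have hf_sum : ∀ y, ∑ v, f y v = 1 := fun y => by
    rw [sum_update_of_mem (mem_univ g₀)]
    ring
  have hfw1 : ∀ y, f y w₁ = max (y i₀) 0 := fun y => by simp [f, q, hg1.symm]
  have hfw2 : ∀ y, f y w₂ = max (-y i₀) 0 := fun y => by simp [f, q, hg2.symm, h12.symm]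
  have hfG : ∀ y (v : G), ι v ≠ i₀ → f y v = y (ι v) := by
    rintro y ⟨v, hv⟩ hne
    have hvg : v ≠ g₀ := fun e => hne (by subst e; rfl)
    have hv1 : v ≠ w₁ := fun e => h1 (e ▸ hv)
    have hv2 : v ≠ w₂ := fun e => h2 (e ▸ hv)
    simp [f, q, hvg, hv1, hv2, hv]
  have hf_zero : ∀ y v, v ≠ w₁ → v ≠ w₂ → v ∉ G → f y v = 0 := by
    intro y v hv1 hv2 hv
    have hvg : v ≠ g₀ := fun e => hv (e ▸ hg₀)
    simp [f, q, hvg, hv1, hv2, hv]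
  have hinj : Function.Injective f := by
    intro y z hyz
    ext i
    rcases eq_or_ne i i₀ with rfl | hi
    · have e1 := congrFun hyz w₁
      have e2 := congrFun hyz w₂
      rw [hfw1, hfw1] at e1
      rw [hfw2, hfw2] at e2
      have := max_zero_sub_max_neg_zero_eq_self (y i₀)
      have := max_zero_sub_max_neg_zero_eq_self (z i₀)
      linarith
    · have hi' : ι (ι.symm i) ≠ i₀ := by simpa using hi
      have e := congrFun hyz (ι.symm i)
      rwa [hfG _ _ hi', hfG _ _ hi', ι.apply_symm_apply] at e
  let V : Set (EuclideanSpace ℝ (Fin m)) := {y | (∀ i, i ≠ i₀ → 0 < y i) ∧ 0 < f y g₀}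
  have hVo : IsOpen V := by
    have hpos : IsOpen {y : EuclideanSpace ℝ (Fin m) | ∀ i, i ≠ i₀ → 0 < y i} := by
      simp only [Set.ofPred_forall]
      exact isOpen_iInter_of_finite fun i => isOpen_iInter_of_finite fun _ =>
        isOpen_lt continuous_const (by fun_prop)
    exact hpos.inter (isOpen_lt continuous_const ((continuous_apply g₀).comp hf))
  have hVR : Set.MapsTo f V (realize Δ) := by
    rintro y ⟨hy, hyg⟩
    have hnn : ∀ v, 0 ≤ f y v := by
      intro v
      by_cases hv1 : v = w₁
      · rw [hv1, hfw1]; exact le_max_right _ _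
      by_cases hv2 : v = w₂
      · rw [hv2, hfw2]; exact le_max_right _ _
      by_cases hv : v ∈ G
      · by_cases hvi : ι ⟨v, hv⟩ = i₀
        · have : v = g₀ := congrArg Subtype.val (ι.injective hvi)
          exact this ▸ hyg.le
        · rw [hfG y ⟨v, hv⟩ hvi]
          exact (hy _ hvi).le
      · exact (hf_zero y v hv1 hv2 hv).ge
    rcases le_total (y i₀) 0 with h0 | h0
    · refine ⟨_, hf2, hnn, fun v hv => ?_, hf_sum y⟩
      rw [mem_insert]
      by_contra! hcon
      refine hv ?_
      by_cases hv1 : v = w₁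
      · rw [hv1, hfw1, max_eq_right h0]
      · exact hf_zero y v hv1 hcon.1 hcon.2
    · refine ⟨_, hf1, hnn, fun v hv => ?_, hf_sum y⟩
      rw [mem_insert]
      by_contra! hcon
      refine hv ?_
      by_cases hv2 : v = w₂
      · rw [hv2, hfw2, max_eq_right (by linarith)]
      · exact hf_zero y v hcon.1 hv2 hcon.2
  let y₀ : EuclideanSpace ℝ (Fin m) :=
    WithLp.toLp 2 fun i => if i = i₀ then 0 else (#G : ℝ)⁻¹
  have hqy : ∀ v ∈ univ \ {g₀}, q y₀ v = if v ∈ G.erase g₀ then (#G : ℝ)⁻¹ else 0 := by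
    intro v hv
    have hvg : v ≠ g₀ := by simpa using hv
    have : ∀ h : v ∈ G, ι ⟨v, h⟩ ≠ i₀ := fun h e => hvg (congrArg Subtype.val (ι.injective e))
    by_cases hv1 : v = w₁
    · simp [q, y₀, hv1, h1]
    by_cases hv2 : v = w₂
    · simp [q, y₀, hv2, h2]
    by_cases hvG : v ∈ G
    · simp [q, y₀, hv1, hv2, hvG, this hvG, hvg]
    · simp [q, y₀, hv1, hv2, hvG]
  have hfg₀ : f y₀ g₀ = (#G : ℝ)⁻¹ := by
    have hsub : G.erase g₀ ⊆ univ \ {g₀} := fun v hv => by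
      simpa using ne_of_mem_erase hv
    simp only [f, Function.update_self]
    rw [sum_congr rfl hqy, sum_ite_mem, inter_eq_right.2 hsub, sum_const, card_erase_of_mem hg₀,
      nsmul_eq_mul, Nat.cast_pred (card_pos.2 ⟨g₀, hg₀⟩)]
    field_simp
    ring
  have hy₀ : y₀ ∈ V := by
    refine ⟨fun i hi => ?_, by rw [hfg₀]; positivity⟩
    simp [y₀, hi, hc0]
  obtain ⟨e, he⟩ := hchart ⟨f y₀, hVR hy₀⟩
  have key := image_mem_nhdsWithin_of_injOn_of_chart (hVR hy₀) he (hVo.mem_nhds hy₀) hVR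
    hf.continuousOn hinj.injOn
  let p : ℝ → Fin N → ℝ := fun t => f y₀ + t • (Pi.single w₃ 1 - Pi.single g₀ 1)
  have hp : ContinuousAt p 0 := by fun_prop
  have hpR : ∀ᶠ t in 𝓝[>] (0 : ℝ), p t ∈ realize Δ := by
    filter_upwards [Ioo_mem_nhdsGT (inv_pos.2 hc0)] with t ht
    have hpg : p t g₀ = (#G : ℝ)⁻¹ - t := by simp [p, hfg₀, hg3, sub_eq_add_neg]
    have hpw : p t w₃ = t := by
      simp [p, hf_zero y₀ w₃ h13.symm h23.symm h3, hg3.symm]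
    have hpv : ∀ v, v ≠ g₀ → v ≠ w₃ → p t v = f y₀ v := fun v hv hv3 => by simp [p, hv, hv3]
    have hfv : ∀ v, 0 ≤ f y₀ v := by
      obtain ⟨-, -, h, -⟩ := hVR hy₀
      exact h
    refine ⟨_, hf3, fun v => ?_, fun v hv => ?_, ?_⟩
    · by_cases hvg : v = g₀
      · rw [hvg, hpg]; linarith [ht.2]
      by_cases hv3 : v = w₃
      · rw [hv3, hpw]; exact ht.1.le
      rw [hpv v hvg hv3]
      exact hfv v
    · rw [mem_insert]
      by_contra! hcon
      have hvg : v ≠ g₀ := fun e => hcon.2 (e ▸ hg₀)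
      refine hv ?_
      rw [hpv v hvg hcon.1]
      by_cases hv1 : v = w₁
      · simp [hv1, hfw1, y₀]
      by_cases hv2 : v = w₂
      · simp [hv2, hfw2, y₀]
      exact hf_zero y₀ v hv1 hv2 hcon.2
    · simp [p, sum_add_distrib, ← mul_sum, hf_sum]
  have hlim : Filter.Tendsto p (𝓝[>] 0) (𝓝[realize Δ] (f y₀)) := by
    refine tendsto_nhdsWithin_iff.2 ⟨?_, hpR⟩
    simpa [p] using hp.tendsto.mono_left nhdsWithin_le_nhds
  obtain ⟨t, ⟨y, -, hy⟩, ht⟩ := ((hlim.eventually key).and self_mem_nhdsWithin).exists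
  have h0 := congrFun hy w₃
  rw [hf_zero y w₃ h13.symm h23.symm h3] at h0
  have hpw : p t w₃ = t := by
    simp [p, hf_zero y₀ w₃ h13.symm h23.symm h3, hg3.symm]
  exact (ne_of_gt ht) (hpw.symm.trans h0.symm)

/-- The `1`-skeleton of `Δ`. -/
def oneSkeleton (Δ : Finset (Finset (Fin N))) : SimpleGraph (Fin N) where
  Adj a b := a ≠ b ∧ {a, b} ∈ Δ
  symm := ⟨fun a b h => ⟨h.1.symm, by rw [pair_comm]; exact h.2⟩⟩
  loopless := ⟨fun _ h => h.1 rfl⟩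

theorem isClique_oneSkeleton_iff (h_down : ∀ F ∈ Δ, ∀ G ⊆ F, G ∈ Δ)
    (h_flag : ∀ F : Finset (Fin N),
      (∀ a ∈ F, ∀ b ∈ F, a ≠ b → ({a, b} : Finset (Fin N)) ∈ Δ) → F ∈ Δ)
    {F : Finset (Fin N)} : (oneSkeleton Δ).IsClique (F : Set (Fin N)) ↔ F ∈ Δ := by
  constructor
  · exact fun h => h_flag F fun a ha b hb hab => (h ha hb hab).2
  · exact fun h a ha b hb hab => ⟨hab, h_down F h _ (insert_subset ha (by simpa using hb))⟩

theorem isFlagPseudomanifold_oneSkeleton (hm : 1 ≤ m) (hN : 2 ≤ N)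
    (h_down : ∀ F ∈ Δ, ∀ G ⊆ F, G ∈ Δ)
    (h_vert : ∀ p : Fin N, ({p} : Finset (Fin N)) ∈ Δ)
    (h_flag : ∀ F : Finset (Fin N),
      (∀ a ∈ F, ∀ b ∈ F, a ≠ b → ({a, b} : Finset (Fin N)) ∈ Δ) → F ∈ Δ)
    (h_dim : ∀ F ∈ Δ, #F ≤ m + 1)
    (h : realize Δ ≃ₜ Metric.sphere (0 : EuclideanSpace ℝ (Fin (m + 1))) 1) :
    IsFlagPseudomanifold (oneSkeleton Δ) univ (m + 1) := by
  have hchart := exists_chart_of_homeomorph_sphere h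
  constructor <;> simp only [isClique_oneSkeleton_iff h_down h_flag]
  · exact fun F _ hF => h_dim F hF
  · intro F _ hF hlt w
    rcases F.eq_empty_or_nonempty with rfl | hne
    · have : Nontrivial (Fin N) := Fin.nontrivial_iff_two_le.2 hN
      obtain ⟨u, hu⟩ := exists_ne w
      exact ⟨u, mem_univ u, hu, by simp, by simpa using h_vert u⟩
    · obtain ⟨F', hF', hsub, hn⟩ := exists_notMem_insert_of_chart hchart hF hne (by omega) w
      obtain ⟨u, huF', hu⟩ := not_subset.1 hn
      rw [mem_insert, not_or] at hu
      exact ⟨u, mem_univ u, hu.1, hu.2, h_down F' hF' _ (insert_subset huF' hsub)⟩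
  · intro F _ hF hcard T _ hT
    by_contra! hlt
    obtain ⟨a, ha, b, hb, c, hc, hab, hac, hbc⟩ := two_lt_card.1 hlt
    exact not_three_insert_mem_of_chart hchart (card_pos.1 (by omega)) (by omega) hab hac hbc
      (hT a ha).1 (hT b hb).1 (hT c hc).1 (hT a ha).2 (hT b hb).2 (hT c hc).2

theorem cliquePoly_oneSkeleton (h_down : ∀ F ∈ Δ, ∀ G ⊆ F, G ∈ Δ)
    (h_flag : ∀ F : Finset (Fin N),
      (∀ a ∈ F, ∀ b ∈ F, a ≠ b → ({a, b} : Finset (Fin N)) ∈ Δ) → F ∈ Δ) :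
    cliquePoly (oneSkeleton Δ) univ = ∑ F ∈ Δ, X ^ #F := by
  refine sum_congr ?_ fun _ _ => rfl
  ext F
  simp [isClique_oneSkeleton_iff h_down h_flag]

theorem aeval_hPoly {d : ℕ} (h_dim : ∀ F ∈ Δ, #F ≤ d) {x : ℚ} (hx : x ≠ 1) :
    aeval x (hPoly d Δ) = (1 - x) ^ d * aeval (x / (1 - x)) (∑ F ∈ Δ, X ^ #F : ℤ[X]) := by
  have hx' : 1 - x ≠ 0 := sub_ne_zero.2 hx.symm
  simp only [hPoly, map_sum, map_mul, map_pow, map_sub, map_one, aeval_X, mul_sum]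
  refine sum_congr rfl fun F hF => ?_
  obtain ⟨k, rfl⟩ := Nat.exists_eq_add_of_le (h_dim F hF)
  rw [Nat.add_sub_cancel_left, div_pow, pow_add]
  field_simp

theorem eq_of_aeval_eq {p q : ℤ[X]} (h : ∀ x : ℚ, x ≠ 1 → aeval x p = aeval x q) : p = q := by
  refine map_injective (Int.castRingHom ℚ) Int.cast_injective ?_
  refine eq_of_infinite_eval_eq _ _ ((Set.finite_singleton (1 : ℚ)).infinite_compl.mono ?_)
  intro x hx
  simpa [aeval_def, eval_map] using h x hx

end Realize

end Realization

/-- A flag simplicial complex of dimension `d-1` (`d ≥ 2`) whose geometric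
realization is homeomorphic to the sphere `S^{d-1}` and which has exactly `2d+2`
vertices (i.e. `γ₁(Δ) = 2`) has `γ`-polynomial `1 + 2t` or `1 + 2t + t²`;
equivalently `h(Δ;t)` equals `(1+t)^d + 2t(1+t)^{d-2}` or
`(1+t)^d + 2t(1+t)^{d-2} + t²(1+t)^{d-4}`. -/
theorem flag_sphere_gamma_two (d : ℕ) (hd : 2 ≤ d)
    (Δ : Finset (Finset (Fin (2 * d + 2))))
    (h_empty : ∅ ∈ Δ)
    (h_down : ∀ F ∈ Δ, ∀ G ⊆ F, G ∈ Δ)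
    (h_vert : ∀ p : Fin (2 * d + 2), ({p} : Finset (Fin (2 * d + 2))) ∈ Δ)
    (h_flag : ∀ F : Finset (Fin (2 * d + 2)),
      (∀ a ∈ F, ∀ b ∈ F, a ≠ b → ({a, b} : Finset (Fin (2 * d + 2))) ∈ Δ) → F ∈ Δ)
    (h_dim : ∀ F ∈ Δ, F.card ≤ d)
    (h_top : ∃ F ∈ Δ, F.card = d)
    (h_sphere : Nonempty
      (realize Δ ≃ₜ Metric.sphere (0 : EuclideanSpace ℝ (Fin d)) 1)) :
    hPoly d Δ = (1 + X) ^ d + 2 * X * (1 + X) ^ (d - 2) ∨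
    hPoly d Δ =
      (1 + X) ^ d + 2 * X * (1 + X) ^ (d - 2) + X ^ 2 * (1 + X) ^ (d - 4) := by
  obtain ⟨m, rfl⟩ : ∃ m, d = m + 1 := ⟨d - 1, by omega⟩
  obtain ⟨h⟩ := h_sphere
  have hpm := isFlagPseudomanifold_oneSkeleton (by omega) (by omega) h_down h_vert h_flag h_dim h
  have hcard : #(univ : Finset (Fin (2 * (m + 1) + 2))) = 2 * (m + 1) + 2 := by simp
  obtain ⟨-, hf⟩ := hpm.cliquePoly_of_card_eq_two_mul_add_two hcard
  rw [cliquePoly_oneSkeleton h_down h_flag] at hf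
  generalize m + 1 = d at *
  have hu : ∀ x : ℚ, x ≠ 1 → 1 + 2 * (x / (1 - x)) = (1 + x) / (1 - x) := fun x hx => by
    have := sub_ne_zero.2 hx.symm
    field_simp
    ring
  have hs : ∀ x : ℚ, x ≠ 1 → x / (1 - x) * (1 + x / (1 - x)) = x / (1 - x) ^ 2 := fun x hx => by
    have := sub_ne_zero.2 hx.symm
    field_simp
    ring
  rcases hf with hf | ⟨h4, hf⟩
  · refine Or.inl (eq_of_aeval_eq fun x hx => ?_)
    have hx' := sub_ne_zero.2 hx.symm
    obtain ⟨e, rfl⟩ := Nat.exists_eq_add_of_le' hd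
    rw [aeval_hPoly h_dim hx, hf]
    simp only [map_add, map_mul, map_pow, map_one, map_ofNat, aeval_X, hu x hx, hs x hx,
      Nat.add_sub_cancel, div_pow]
    field_simp
    ring
  · refine Or.inr (eq_of_aeval_eq fun x hx => ?_)
    have hx' := sub_ne_zero.2 hx.symm
    obtain ⟨e, rfl⟩ := Nat.exists_eq_add_of_le' h4
    rw [aeval_hPoly h_dim hx, hf]
    simp only [map_add, map_mul, map_pow, map_one, map_ofNat, aeval_X, hu x hx, hs x hx,
      Nat.add_sub_cancel, show e + 4 - 2 = e + 2 by omega, div_pow]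
    field_simp
    ring
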